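/- Fix 0 ≤ k ≤ n. The set {α ∈ ℤ_+^t : the pair (α, Q_{b(α)}^{(k)}) is irreducible w.r.t. ⊴} is finite. -/

import Mathlib

open Matrix Pointwise

/-- Partially extended fiber of order `k`: `Q_b^{(k)} = {z ∈ ℤ^n : Az = b, z_i ≥ 0 for i < k}`. -/
def Qfib {d n : ℕ} (A : Matrix (Fin d) (Fin n) ℤ) (k : ℕ) (b : Fin d → ℤ) :
    Set (Fin n → ℤ) :=
  {z | A.mulVec z = b ∧ ∀ i : Fin n, (i : ℕ) < k → 0 ≤ z i}

/-- `u ⊑_l v`: componentwise sign-compatible and dominated on the first `l` components. -/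
def sqle (n l : ℕ) (u v : Fin n → ℤ) : Prop :=
  ∀ i : Fin n, (i : ℕ) < l → 0 ≤ u i * v i ∧ |u i| ≤ |v i|

/-- `U = V ⊕^{(l)} W`: every `u ∈ U` splits as `u = v + w` with `v ∈ V`, `w ∈ W`,
`v ⊑_l u` and `w ⊑_l u`. -/
def oplus {n : ℕ} (l : ℕ) (U V W : Set (Fin n → ℤ)) : Prop :=
  ∀ u ∈ U, ∃ v ∈ V, ∃ w ∈ W, sqle n l v u ∧ sqle n l w u ∧ u = v + w

/-- Projection onto the first `l` components (encoded by zeroing the others). -/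
def projVec (n l : ℕ) (z : Fin n → ℤ) : Fin n → ℤ :=
  fun i => if (i : ℕ) < l then z i else 0

/-- `π_l(U)`. -/
def projSet {n : ℕ} (l : ℕ) (U : Set (Fin n → ℤ)) : Set (Fin n → ℤ) :=
  projVec n l '' U

/-- The submonoid of `ℤ^d` generated by `m_1, …, m_t`. -/
def monoidGen {d t : ℕ} (m : Fin t → Fin d → ℤ) : Set (Fin d → ℤ) :=
  {b | ∃ α : Fin t → ℕ, b = ∑ i, (α i : ℤ) • m i}

/-- `Q_b^{(k)}` is atomic w.r.t. `⊕^{(l)}` and `M`. -/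
def AtomicFiber {d n : ℕ} (A : Matrix (Fin d) (Fin n) ℤ) (k l : ℕ)
    (M : Set (Fin d → ℤ)) (b : Fin d → ℤ) : Prop :=
  ¬ ∃ b₁ ∈ M, ∃ b₂ ∈ M,
      oplus l (Qfib A k b) (Qfib A k b₁) (Qfib A k b₂) ∧
      projSet l (Qfib A k b₁) ≠ projSet l (Qfib A k (0 : Fin d → ℤ)) ∧
      projSet l (Qfib A k b₂) ≠ projSet l (Qfib A k (0 : Fin d → ℤ))

/-- `Q_b^{(k)}` is atomic w.r.t. `⊕ = ⊕^{(n)}` and `M` (fiber-inequality form, since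
`π_n` is the identity). -/
def AtomicFiberQ {d n : ℕ} (A : Matrix (Fin d) (Fin n) ℤ) (k : ℕ)
    (M : Set (Fin d → ℤ)) (b : Fin d → ℤ) : Prop :=
  ¬ ∃ b₁ ∈ M, ∃ b₂ ∈ M,
      oplus n (Qfib A k b) (Qfib A k b₁) (Qfib A k b₂) ∧
      Qfib A k b₁ ≠ Qfib A k (0 : Fin d → ℤ) ∧
      Qfib A k b₂ ≠ Qfib A k (0 : Fin d → ℤ)

/-- `S̄^{(l)}`: integer combinations of the last `n - l` columns of `A` that lie in `M`. -/
def SbarSet {d n : ℕ} (A : Matrix (Fin d) (Fin n) ℤ) (l : ℕ)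
    (M : Set (Fin d → ℤ)) : Set (Fin d → ℤ) :=
  {s | s ∈ M ∧ ∃ lam : Fin n → ℤ, (∀ i : Fin n, (i : ℕ) < l → lam i = 0) ∧ s = A.mulVec lam}

/-- `U = ⊕^{(l)}_{j} V_j` for a finite family. -/
def oplusFam {n : ℕ} (l : ℕ) {r : ℕ} (U : Set (Fin n → ℤ))
    (V : Fin r → Set (Fin n → ℤ)) : Prop :=
  ∀ u ∈ U, ∃ v : Fin r → Fin n → ℤ,
    (∀ j, v j ∈ V j) ∧ (∀ j, sqle n l (v j) u) ∧ u = ∑ j, v j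

/-- `b(α) = Σ α_i m_i`. -/
def bOf {d t : ℕ} (m : Fin t → Fin d → ℤ) (α : Fin t → ℕ) : Fin d → ℤ :=
  ∑ i, (α i : ℤ) • m i

/-- `(β, Q_{b(β)}^{(k)})` reduces `(α, Q_{b(α)}^{(k)})`. -/
def Reduces {d n t : ℕ} (A : Matrix (Fin d) (Fin n) ℤ) (m : Fin t → Fin d → ℤ)
    (k : ℕ) (β α : Fin t → ℕ) : Prop :=
  β ≤ α ∧
    oplus n (Qfib A k (bOf m α)) (Qfib A k (bOf m β)) (Qfib A k (bOf m α - bOf m β))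

/-- The complement of a finitely generated upper set of `ι → ℕ` is a finite union of boxes
`{x | ∀ i, x i < a i}` with corners `a : ι → ℕ∞`. -/
theorem exists_boxes_iff_forall_not_le {ι : Type*} [Finite ι] (F : Finset (ι → ℕ)) :
    ∃ L : List (ι → ℕ∞), ∀ x : ι → ℕ,
      (∀ g ∈ F, ¬ g ≤ x) ↔ ∃ a ∈ L, ∀ i, (x i : ℕ∞) < a i := by
  classical
  have := Fintype.ofFinite ι
  induction F using Finset.induction_on with
  | empty => exact ⟨[⊤], fun x => by simp⟩
  | insert g F _ ih =>
    obtain ⟨L, hL⟩ := ih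
    refine ⟨(L ×ˢ (Finset.univ : Finset ι).toList).map
      fun p => p.1 ⊓ Function.update ⊤ p.2 (g p.2 : ℕ∞), fun x => ?_⟩
    rw [Finset.forall_mem_insert, hL]
    constructor
    · rintro ⟨hg, a, ha, hax⟩
      simp only [Pi.le_def, not_forall, not_le] at hg
      obtain ⟨i, hi⟩ := hg
      refine ⟨_, List.mem_map_of_mem (a := (a, i)) (by simpa using ha), fun j => ?_⟩
      rcases eq_or_ne j i with rfl | hji
      · simpa using ⟨hax j, hi⟩
      · simpa [hji] using hax j
    · rintro ⟨_, hmem, hx⟩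
      obtain ⟨⟨a, i⟩, hp, rfl⟩ := List.mem_map.1 hmem
      simp only [Pi.inf_apply, lt_inf_iff] at hx
      refine ⟨fun hg => ?_, a, (List.mem_product.1 hp).1, fun j => (hx j).1⟩
      have hi := (hx i).2
      rw [Function.update_self, Nat.cast_lt] at hi
      exact hi.not_ge (hg i)

/-- The complement of an upper set of `ι → ℕ` is a finite union of boxes. -/
theorem UpperSet.exists_boxes_iff_notMem {ι : Type*} [Finite ι] (U : UpperSet (ι → ℕ)) :
    ∃ L : List (ι → ℕ∞), ∀ x : ι → ℕ, x ∉ U ↔ ∃ a ∈ L, ∀ i, (x i : ℕ∞) < a i := by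
  have hfin : {x | Minimal (· ∈ U) x}.Finite :=
    WellQuasiOrderedLE.finite_of_isAntichain (setOfPred_minimal_antichain _)
  obtain ⟨L, hL⟩ := exists_boxes_iff_forall_not_le hfin.toFinset
  refine ⟨L, fun x => ?_⟩
  rw [← hL]
  constructor
  · exact fun hx g hg hgx => hx (U.upper hgx (hfin.mem_toFinset.1 hg).1)
  · intro h hx
    obtain ⟨g, hgx, hg⟩ := exists_minimal_le_of_wellFoundedLT (· ∈ U) x hx
    exact h g (hfin.mem_toFinset.2 hg) hgx

theorem List.SublistForall₂.exists_mem_of_mem {α β : Type*} {r : α → β → Prop}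
    {l₁ : List α} {l₂ : List β} (h : List.SublistForall₂ r l₁ l₂) {a : α} (ha : a ∈ l₁) :
    ∃ b ∈ l₂, r a b := by
  induction h with
  | nil => simp at ha
  | cons hr _ ih =>
    rcases List.mem_cons.1 ha with rfl | ha
    · exact ⟨_, List.mem_cons_self, hr⟩
    · obtain ⟨b, hb, hab⟩ := ih ha
      exact ⟨b, List.mem_cons_of_mem _ hb, hab⟩
  | cons_right _ ih =>
    obtain ⟨b, hb, hab⟩ := ih ha
    exact ⟨b, List.mem_cons_of_mem _ hb, hab⟩

/-- Upper sets of `ι → ℕ` are well-quasi-ordered by reverse inclusion. -/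
theorem UpperSet.wellQuasiOrderedLE_pi_nat {ι : Type*} [Finite ι] :
    WellQuasiOrderedLE (UpperSet (ι → ℕ)) := by
  refine ⟨fun f => ?_⟩
  choose L hL using fun n => (f n).exists_boxes_iff_notMem
  obtain ⟨m, n, hmn, h⟩ :=
    (Set.isPWO_of_wellQuasiOrderedLE (Set.univ : Set (ι → ℕ∞)))
      |>.partiallyWellOrderedOn_sublistForall₂ (· ≤ ·)
      |>.exists_lt (f := L) (by simp)
  refine ⟨m, n, hmn, fun x hx => ?_⟩
  by_contra hxm
  obtain ⟨a, ha, hax⟩ := (hL m x).1 hxm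
  obtain ⟨b, hb, hab⟩ := h.exists_mem_of_mem ha
  exact (hL n x).2 ⟨b, hb, fun i => (hax i).trans_le (hab i)⟩ hx

/-- The positive and negative parts of an integer vector, as one vector of naturals. -/
def posNegParts {n : ℕ} (u : Fin n → ℤ) : Fin n ⊕ Fin n → ℕ :=
  Sum.elim (fun i => (u i).toNat) (fun i => (-u i).toNat)

theorem sign_compatible_of_posNegParts_le {n : ℕ} {v u : Fin n → ℤ}
    (h : posNegParts v ≤ posNegParts u) (i : Fin n) :
    0 ≤ v i ∧ v i ≤ u i ∨ u i ≤ v i ∧ v i ≤ 0 := by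
  have h₁ := h (Sum.inl i)
  have h₂ := h (Sum.inr i)
  simp only [posNegParts, Sum.elim_inl, Sum.elim_inr] at h₁ h₂
  omega

theorem sqle_of_sign_compatible {n l : ℕ} {v u : Fin n → ℤ}
    (h : ∀ i, 0 ≤ v i ∧ v i ≤ u i ∨ u i ≤ v i ∧ v i ≤ 0) : sqle n l v u := by
  intro i _
  rcases h i with ⟨h₁, h₂⟩ | ⟨h₁, h₂⟩
  · exact ⟨mul_nonneg h₁ (h₁.trans h₂), abs_le_abs_of_nonneg h₁ h₂⟩
  · exact ⟨mul_nonneg_of_nonpos_of_nonpos h₂ (h₁.trans h₂), abs_le_abs_of_nonpos h₂ h₁⟩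

theorem oplus_Qfib_of_upperClosure_le {d n : ℕ} {A : Matrix (Fin d) (Fin n) ℤ} {k l : ℕ}
    {b c : Fin d → ℤ}
    (h : upperClosure (posNegParts '' Qfib A k c) ≤ upperClosure (posNegParts '' Qfib A k b)) :
    oplus l (Qfib A k b) (Qfib A k c) (Qfib A k (b - c)) := by
  intro u hu
  obtain ⟨_, ⟨v, hv, rfl⟩, hvu⟩ :=
    mem_upperClosure.1 (h (subset_upperClosure (Set.mem_image_of_mem posNegParts hu)))
  have hc := sign_compatible_of_posNegParts_le hvu
  refine ⟨v, hv, u - v, ⟨?_, fun i hi => ?_⟩, sqle_of_sign_compatible hc,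
    sqle_of_sign_compatible fun i => ?_, (add_sub_cancel v u).symm⟩
  · rw [Matrix.mulVec_sub, hu.1, hv.1]
  · have := hc i
    have := hu.2 i hi
    have := hv.2 i hi
    simp only [Pi.sub_apply]
    omega
  · have := hc i
    simp only [Pi.sub_apply]
    omega

/-- There are only finitely many `α ∈ ℤ_+^t` such that the pair `(α, Q_{b(α)}^{(k)})` is
irreducible w.r.t. `⊴`. -/
theorem stmt3 (d n t : ℕ) (hn : 0 < n) (A : Matrix (Fin d) (Fin n) ℤ)
    (m : Fin t → Fin d → ℤ) (k : ℕ) (hk : k ≤ n) :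
    Set.Finite {α : Fin t → ℕ |
      ∀ β : Fin t → ℕ, Reduces A m k β α → β = α ∨ β = 0} := by
  by_contra hinf
  have hinf' := (Set.Infinite.sdiff hinf (Set.finite_singleton 0)).to_subtype
  let f := Infinite.natEmbedding
    ↑({α : Fin t → ℕ | ∀ β, Reduces A m k β α → β = α ∨ β = 0} \ {0})
  have := UpperSet.wellQuasiOrderedLE_pi_nat (ι := Fin n ⊕ Fin n)
  obtain ⟨i, j, hij, hle, hcl⟩ := wellQuasiOrdered_le fun i =>
    ((f i : Fin t → ℕ), upperClosure (posNegParts '' Qfib A k (bOf m (f i))))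
  rcases (f j).2.1 _ ⟨hle, oplus_Qfib_of_upperClosure_le hcl⟩ with h | h
  · exact hij.ne (f.injective (Subtype.ext h))
  · exact (f i).2.2 h
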